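/- arXiv:0803.3355 — 2 statements merged into one kernel-verified Lean document; each statement's English description precedes it below -/
import Mathlib

section
/- Let u ∈ ℚ[k₁,…,k_n] be an increasing polynomial such that for each index i the degree of u in the variable k_i is at least 2 and the leading coefficient of u regarded as a polynomial in k_i (a polynomial in the remaining variables) takes strictly positive values at every point of ℤ_{≥0}^{n−1}. Then there exist a real number a > 0 and b ∈ ℝ such that u(k) ≥ a·k_i² + b for every k ∈ ℤ_{≥0}ⁿ and every index i ∈ {1,…,n}. -/
open MvPolynomial

/-- A polynomial `f ∈ ℚ[x₁,…,xₙ]` is *increasing* if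
`f(x + eᵢ) ≥ f(x)` for every `x ∈ ℤ_{≥0}ⁿ` and each standard basis vector. -/
def IsIncreasingPoly {n : ℕ} (f : MvPolynomial (Fin n) ℚ) : Prop :=
  ∀ (x : Fin n → ℕ) (i : Fin n),
    eval (fun j => (x j : ℚ)) f ≤
      eval (fun j => ((x j + if j = i then 1 else 0 : ℕ) : ℚ)) f

/-- The univariate polynomial in the variable `kᵢ` obtained from `u` by
substituting the natural numbers `y j` for the variables `kⱼ`, `j ≠ i`. -/
noncomputable def sectionPoly {n : ℕ} (u : MvPolynomial (Fin n) ℚ) (i : Fin n)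
    (y : Fin n → ℕ) : Polynomial ℚ :=
  aeval (fun j => if j = i then Polynomial.X else Polynomial.C ((y j : ℚ))) u


lemma poly_quad_bound (p : Polynomial ℝ) (hd : 2 ≤ p.natDegree) (hl : 0 < p.leadingCoeff) :
    ∃ a > (0 : ℝ), ∃ b : ℝ, ∀ m : ℕ, a * (m : ℝ) ^ 2 + b ≤ p.eval (m : ℝ) := by
  have hp0 : p ≠ 0 := by rintro rfl; simp at hl
  have hdeg : (Polynomial.X ^ 2 : Polynomial ℝ).degree ≤ p.degree := by
    rw [Polynomial.degree_X_pow, Polynomial.degree_eq_natDegree hp0]; exact_mod_cast hd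
  have hO := Polynomial.isBigO_atTop_of_degree_le _ _ hdeg
  obtain ⟨c, hc, hcb⟩ := hO.exists_pos
  have h1 := hcb.bound
  have ht : Filter.Tendsto (fun x => p.eval x) Filter.atTop Filter.atTop := by
    apply Polynomial.tendsto_atTop_of_leadingCoeff_nonneg p _ hl.le
    rw [Polynomial.degree_eq_natDegree hp0]; exact_mod_cast (by omega : 0 < p.natDegree)
  have h2 := ht.eventually_ge_atTop 0
  have h3 : ∀ᶠ m : ℕ in Filter.atTop, 0 ≤ p.eval (m : ℝ) - c⁻¹ * (m : ℝ) ^ 2 := by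
    have := (tendsto_natCast_atTop_atTop (R := ℝ)).eventually (h1.and h2)
    filter_upwards [this] with m hm
    obtain ⟨ha, hb⟩ := hm
    simp only [Polynomial.eval_pow, Polynomial.eval_X, Real.norm_eq_abs, abs_of_nonneg hb] at ha
    rw [abs_of_nonneg (by positivity)] at ha
    have : c⁻¹ * (m : ℝ) ^ 2 ≤ c⁻¹ * (c * p.eval (m : ℝ)) := by gcongr
    rw [inv_mul_cancel_left₀ hc.ne'] at this
    linarith
  have h4 : BddBelow (Set.range fun m : ℕ => p.eval (m : ℝ) - c⁻¹ * (m : ℝ) ^ 2) :=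
    (Filter.isBoundedUnder_of_eventually_ge h3).bddBelow_range
  obtain ⟨b, hb⟩ := h4
  refine ⟨c⁻¹, by positivity, b, fun m => ?_⟩
  have := hb ⟨m, rfl⟩
  simp only at this
  linarith

lemma natDegree_sectionPoly_le {n : ℕ} (u : MvPolynomial (Fin n) ℚ) (i : Fin n)
    (y : Fin n → ℕ) : (sectionPoly u i y).natDegree ≤ u.degreeOf i := by
  unfold sectionPoly
  rw [aeval_def, eval₂_eq]
  apply Polynomial.natDegree_sum_le_of_forall_le
  intro m hm
  refine le_trans ?_ (monomial_le_degreeOf i hm)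
  refine (Polynomial.natDegree_C_mul_le _ _).trans ?_
  refine (Polynomial.natDegree_prod_le _ _).trans ?_
  refine (Finset.sum_le_sum (g := fun j => if j = i then m j else 0) ?_).trans ?_
  · intro j _
    split_ifs with h
    · simp
    · rw [← Polynomial.C_pow]; simp
  · rw [Finset.sum_ite_eq' m.support i]
    split_ifs <;> simp

lemma eval_sectionPoly {n : ℕ} (u : MvPolynomial (Fin n) ℚ) (i : Fin n)
    (m : ℕ) : (sectionPoly u i 0).eval (m : ℚ) =
      eval (fun j => ((Pi.single i m : Fin n → ℕ) j : ℚ)) u := by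
  unfold sectionPoly
  rw [← Polynomial.coe_evalRingHom, aeval_def, hom_eval₂, ← eval₂_id]
  congr 1
  · ext; simp
  · funext j
    by_cases h : j = i
    · subst h; simp
    · simp [h]

lemma mono_eval {n : ℕ} (u : MvPolynomial (Fin n) ℚ) (hu : IsIncreasingPoly u)
    (x d : Fin n → ℕ) :
    eval (fun j => (x j : ℚ)) u ≤ eval (fun j => ((x + d) j : ℚ)) u := by
  have step : ∀ (i : Fin n) (c : ℕ) (x : Fin n → ℕ),
      eval (fun j => (x j : ℚ)) u ≤
        eval (fun j => ((x + Pi.single i c : Fin n → ℕ) j : ℚ)) u := by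
    intro i c x
    induction c with
    | zero => simp
    | succ c ih =>
      refine ih.trans ((hu _ i).trans (le_of_eq ?_))
      congr 2
      funext j
      by_cases h : j = i
      · subst h; simp [add_assoc]
      · simp [h]
  have key : ∀ s : Finset (Fin n), eval (fun j => (x j : ℚ)) u ≤
        eval (fun j => ((x + ∑ i ∈ s, Pi.single i (d i) : Fin n → ℕ) j : ℚ)) u := by
    intro s
    induction s using Finset.induction_on with
    | empty => simp
    | insert i s hi ih =>
      rw [Finset.sum_insert hi, add_comm (Pi.single i (d i) : Fin n → ℕ), ← add_assoc]
      exact ih.trans (step _ _ _)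
  have := key Finset.univ
  rwa [Finset.univ_sum_single] at this

theorem quadratic_lower_bound_of_deg_two_increasing
    (n : ℕ) (u : MvPolynomial (Fin n) ℚ) (hu : IsIncreasingPoly u)
    (hdeg : ∀ i : Fin n, 2 ≤ u.degreeOf i)
    (hlead : ∀ (i : Fin n) (y : Fin n → ℕ),
      0 < (sectionPoly u i y).coeff (u.degreeOf i)) :
    ∃ a > (0 : ℝ), ∃ b : ℝ, ∀ (k : Fin n → ℕ) (i : Fin n),
      a * (k i : ℝ) ^ 2 + b ≤ ((eval (fun j => (k j : ℚ)) u : ℚ) : ℝ) := by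
  have h : ∀ i : Fin n, ∃ a > (0 : ℝ), ∃ b : ℝ, ∀ m : ℕ, a * (m : ℝ) ^ 2 + b ≤
      (((sectionPoly u i 0).eval (m : ℚ) : ℚ) : ℝ) := by
    intro i
    have hn : (sectionPoly u i 0).natDegree = u.degreeOf i :=
      le_antisymm (natDegree_sectionPoly_le u i 0)
        (Polynomial.le_natDegree_of_ne_zero (hlead i 0).ne')
    have hl : 0 < (sectionPoly u i 0).leadingCoeff := by
      rw [Polynomial.leadingCoeff, hn]; exact hlead i 0
    obtain ⟨a, ha, b, hb⟩ := poly_quad_bound ((sectionPoly u i 0).map (algebraMap ℚ ℝ))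
      (by rw [Polynomial.natDegree_map, hn]; exact hdeg i)
      (by rw [Polynomial.leadingCoeff_map]; simpa using hl)
    refine ⟨a, ha, b, fun m => (hb m).trans (le_of_eq ?_)⟩
    have := Polynomial.eval_map_apply (p := sectionPoly u i 0) (f := algebraMap ℚ ℝ) (m : ℚ)
    simpa using this
  choose a ha b hb using h
  obtain ⟨M, hM⟩ := Finite.exists_le (fun i => (a i)⁻¹)
  obtain ⟨B, hB⟩ := Finite.exists_le (fun i => - b i)
  refine ⟨(max M 1)⁻¹, by positivity, -B, fun k i => ?_⟩
  have h1 : (max M 1)⁻¹ ≤ a i := inv_le_of_inv_le₀ (ha i) ((hM i).trans (le_max_left _ _))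
  have h2 : -B ≤ b i := by linarith [hB i]
  have h3 : (max M 1)⁻¹ * (k i : ℝ) ^ 2 + -B ≤ a i * (k i : ℝ) ^ 2 + b i := by gcongr
  refine (h3.trans (hb i (k i))).trans ?_
  rw [eval_sectionPoly]
  have h4 := mono_eval u hu (Pi.single i (k i)) (k - Pi.single i (k i))
  rw [add_tsub_cancel_of_le] at h4
  · exact_mod_cast h4
  · intro j
    by_cases h : j = i
    · subst h; simp
    · simp [h]
end

section
/- Let r, δ, N be positive integers, d a nonnegative integer, and f : ℤ_{≥0}^r → ℚ a function. Assume that for every index i ∈ {1,…,r} and every fixed choice of values in ℤ_{≥0} for the coordinates other than the i-th, there exist polynomials p₀,…,p_{δ−1} ∈ ℚ[x] (depending on i and on the fixed coordinates), each of degree at most d, such that f(n₁,…,n_r) = p_{(n_i mod δ)}(n_i) whenever n_i ≥ N. Then there exist a positive integer N′ and polynomials P_c ∈ ℚ[x₁,…,x_r], indexed by c ∈ (ℤ/δℤ)^r, such that f(n₁,…,n_r) = P_{(n₁ mod δ, …, n_r mod δ)}(n₁,…,n_r) whenever n_i ≥ N′ for every i. -/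
open MvPolynomial

/-- Interpolation nodes in the residue class `c`. -/
def quasiNode (δ N : ℕ) (c : ZMod δ) (k : ℕ) : ℕ := c.val + δ * (N + k)

theorem multivariate_quasipolynomial_of_sections
    (r δ N : ℕ) (hr : 0 < r) (hδ : 0 < δ) (hN : 0 < N) (d : ℕ)
    (f : (Fin r → ℕ) → ℚ)
    (hf : ∀ (i : Fin r) (y : Fin r → ℕ),
      ∃ P : ZMod δ → Polynomial ℚ,
        (∀ c, (P c).natDegree ≤ d) ∧
        ∀ t : ℕ, N ≤ t →
          f (Function.update y i t) = (P (t : ZMod δ)).eval (t : ℚ)) :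
    ∃ N' : ℕ, 0 < N' ∧
      ∃ P : ((Fin r → ZMod δ) → MvPolynomial (Fin r) ℚ),
        ∀ x : Fin r → ℕ, (∀ i, N' ≤ x i) →
          f x = eval (fun i => (x i : ℚ)) (P fun i => (x i : ZMod δ)) := by
  have : NeZero δ := ⟨hδ.ne'⟩
  have node_ge : ∀ c k, N ≤ quasiNode δ N c k := by
    intro c k
    unfold quasiNode
    nlinarith
  have node_cast : ∀ c k, ((quasiNode δ N c k : ℕ) : ZMod δ) = c := by
    intro c k
    simp [quasiNode]
  have node_inj : ∀ c, Set.InjOn (fun k => (quasiNode δ N c k : ℚ))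
      (Finset.range (d + 1) : Finset ℕ) := by
    intro c a _ b _ hab
    have h : quasiNode δ N c a = quasiNode δ N c b := Nat.cast_injective (R := ℚ) hab
    unfold quasiNode at h
    have h2 := Nat.eq_of_mul_eq_mul_left hδ (Nat.add_left_cancel h)
    omega
  -- one-variable interpolation
  have key : ∀ (i : Fin r) (y : Fin r → ℕ) (t : ℕ), N ≤ t →
      f (Function.update y i t) = ∑ k ∈ Finset.range (d + 1),
        f (Function.update y i (quasiNode δ N (t : ZMod δ) k)) *
          (Lagrange.basis (Finset.range (d + 1))
            (fun k => (quasiNode δ N (t : ZMod δ) k : ℚ)) k).eval (t : ℚ) := by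
    intro i y t ht
    obtain ⟨P, hP, hPe⟩ := hf i y
    have hdeg : (P (t : ZMod δ)).degree < (Finset.range (d + 1)).card := by
      rw [Finset.card_range]
      refine lt_of_le_of_lt Polynomial.degree_le_natDegree ?_
      exact_mod_cast Nat.lt_succ_of_le (hP _)
    have h := Lagrange.eq_interpolate (node_inj (t : ZMod δ)) hdeg
    rw [hPe t ht, h, Lagrange.interpolate_apply, Polynomial.eval_finsetSum]
    refine Finset.sum_congr rfl fun k _ => ?_
    rw [hPe _ (node_ge _ k), node_cast, Polynomial.eval_mul, Polynomial.eval_C]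
  have main : ∀ S : Finset (Fin r), ∀ y : Fin r → ℕ,
      ∃ P : ((Fin r → ZMod δ) → MvPolynomial (Fin r) ℚ),
        ∀ x : Fin r → ℕ, (∀ i, N ≤ x i) →
          f (S.piecewise x y) =
            eval (fun i => (x i : ℚ)) (P fun i => (x i : ZMod δ)) := by
    intro S
    induction S using Finset.induction_on with
    | empty =>
      intro y
      exact ⟨fun _ => C (f y), fun x _ => by simp⟩
    | insert i S hi ih =>
      intro y
      choose Q hQ using ih
      refine ⟨fun c => ∑ k ∈ Finset.range (d + 1),
        Q (Function.update y i (quasiNode δ N (c i) k)) c *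
          Polynomial.aeval (X i) (Lagrange.basis (Finset.range (d + 1))
            (fun k => (quasiNode δ N (c i) k : ℚ)) k), fun x hx => ?_⟩
      rw [Finset.piecewise_insert, key i _ _ (hx i), map_sum]
      refine Finset.sum_congr rfl fun k _ => ?_
      rw [map_mul, ← hQ _ x hx]
      congr 1
      · congr 1
        ext j
        by_cases hj : j = i
        · subst hj
          simp [hi]
        · by_cases hjS : j ∈ S <;> simp [hj, hjS]
      · rw [← MvPolynomial.coe_aeval_eq_eval, RingHom.coe_coe,
          ← Polynomial.aeval_algHom_apply, MvPolynomial.aeval_X,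
          Polynomial.coe_aeval_eq_eval]
  obtain ⟨P, hP⟩ := main Finset.univ 0
  exact ⟨N, hN, P, fun x hx => by simpa using hP x hx⟩
end
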